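/- Let Γ be a discrete group acting by homeomorphisms on a compact metrizable space Y with at least 3 points, such that the action on the space of distinct triples of Y is proper (a convergence action). Suppose p ∈ Y is a conical point: there exist a sequence γ_n ∈ Γ and distinct a, b ∈ Y with γ_n·p → a and γ_n·y → b for every y ≠ p. Then p is not a bounded parabolic point; in particular, a point of Y cannot be simultaneously conical and bounded parabolic. -/

import Mathlib

open Filter

/-- Limits along an ultrafilter of a wandering family: no distinct triple can be sent to a distinct
triple. -/
lemma no_triple {Γ Y : Type*} [Group Γ]
    [TopologicalSpace Y] [CompactSpace Y] [T2Space Y] [MulAction Γ Y]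
    (hconv : ∀ K : Set (Y × Y × Y), IsCompact K →
      (∀ t ∈ K, t.1 ≠ t.2.1 ∧ t.1 ≠ t.2.2 ∧ t.2.1 ≠ t.2.2) →
      Set.Finite {γ : Γ | ∃ t ∈ K, ((γ • t.1, γ • t.2.1, γ • t.2.2) : Y × Y × Y) ∈ K})
    (u : Ultrafilter ℕ) (f : ℕ → Γ) (hf : ∀ g, ∀ᶠ n in (u : Filter ℕ), f n ≠ g)
    {x y z : ℕ → Y} {x0 y0 z0 x1 y1 z1 : Y}
    (hx : Tendsto x u (nhds x0)) (hy : Tendsto y u (nhds y0)) (hz : Tendsto z u (nhds z0))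
    (hx1 : Tendsto (fun n => f n • x n) u (nhds x1))
    (hy1 : Tendsto (fun n => f n • y n) u (nhds y1))
    (hz1 : Tendsto (fun n => f n • z n) u (nhds z1))
    (h01 : x0 ≠ y0) (h02 : x0 ≠ z0) (h03 : y0 ≠ z0)
    (h11 : x1 ≠ y1) (h12 : x1 ≠ z1) (h13 : y1 ≠ z1) : False := by
  have hopen : IsOpen {t : Y × Y × Y | t.1 ≠ t.2.1 ∧ t.1 ≠ t.2.2 ∧ t.2.1 ≠ t.2.2} := by
    refine IsOpen.inter ?_ (IsOpen.inter ?_ ?_)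
    · exact isOpen_ne_fun (by fun_prop) (by fun_prop)
    · exact isOpen_ne_fun (by fun_prop) (by fun_prop)
    · exact isOpen_ne_fun (by fun_prop) (by fun_prop)
  obtain ⟨K1, hK1, hm1, hs1⟩ := exists_compact_subset hopen
    (show (x0, y0, z0) ∈ _ from ⟨h01, h02, h03⟩)
  obtain ⟨K2, hK2, hm2, hs2⟩ := exists_compact_subset hopen
    (show (x1, y1, z1) ∈ _ from ⟨h11, h12, h13⟩)
  have hfin := hconv (K1 ∪ K2) (hK1.union hK2)
    (fun t ht => (Set.union_subset hs1 hs2) ht)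
  have t1 := (hx.prodMk_nhds (hy.prodMk_nhds hz)) (mem_interior_iff_mem_nhds.1 hm1)
  have t2 := (hx1.prodMk_nhds (hy1.prodMk_nhds hz1)) (mem_interior_iff_mem_nhds.1 hm2)
  have hav := (hfin.eventually_all (l := (u : Filter ℕ)) (p := fun g n => f n ≠ g)).2
    (fun g _ => hf g)
  obtain ⟨n, ⟨hn1, hn2⟩, hn3⟩ := ((Filter.inter_mem t1 t2 : _ ∈ (u : Filter ℕ)) |>
    fun h => (Filter.Eventually.and h hav).exists)
  exact hn3 (f n) ⟨_, Or.inl hn1, Or.inr hn2⟩ rfl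

lemma ulim {Y : Type*} [TopologicalSpace Y] [CompactSpace Y] (u : Ultrafilter ℕ) (x : ℕ → Y) :
    ∃ c, Tendsto x u (nhds c) := by
  obtain ⟨c, -, hc⟩ := isCompact_univ.ultrafilter_le_nhds (u.map x) (by simp)
  exact ⟨c, hc⟩

lemma loxo {Γ Y : Type*} [Group Γ]
    [TopologicalSpace Y] [CompactSpace Y] [T2Space Y] [MulAction Γ Y]
    (hconv : ∀ K : Set (Y × Y × Y), IsCompact K →
      (∀ t ∈ K, t.1 ≠ t.2.1 ∧ t.1 ≠ t.2.2 ∧ t.2.1 ≠ t.2.2) →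
      Set.Finite {γ : Γ | ∃ t ∈ K, ((γ • t.1, γ • t.2.1, γ • t.2.2) : Y × Y × Y) ∈ K})
    (u : Ultrafilter ℕ) (f : ℕ → Γ) (hf : ∀ g, ∀ᶠ n in (u : Filter ℕ), f n ≠ g)
    {as bs : ℕ → Y} {a b w : Y} (hab : a ≠ b) (hwa : w ≠ a) (hwb : w ≠ b)
    (ha : Tendsto as u (nhds a)) (hb : Tendsto bs u (nhds b))
    (ha1 : Tendsto (fun n => f n • as n) u (nhds a))
    (hb1 : Tendsto (fun n => f n • bs n) u (nhds b))
    (hw : Tendsto (fun n => f n • w) u (nhds a))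
    {U V : Set Y} (hU : IsOpen U) (hV : IsOpen V) (haU : a ∈ U) (hbV : b ∈ V) :
    ∀ᶠ n in (u : Filter ℕ), ∀ y, y ∉ U → (f n)⁻¹ • y ∈ V := by
  have hwc : Tendsto (fun _ : ℕ => w) u (nhds w) := tendsto_const_nhds
  have key1 : ∀ (y : ℕ → Y) (y0 : Y), Tendsto y u (nhds y0) → y0 ≠ a → y0 ≠ b →
      Tendsto (fun n => (f n)⁻¹ • y n) u (nhds b) := by
    intro y y0 hy hya hyb
    obtain ⟨x, hx⟩ := ulim u (fun n => (f n)⁻¹ • y n)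
    by_cases hxb : x = b
    · rwa [hxb] at hx
    exfalso
    have hx1 : Tendsto (fun n => f n • (f n)⁻¹ • y n) u (nhds y0) := by simpa using hy
    by_cases hxa : x = a
    · exact no_triple hconv u f hf hx hwc hb hx1 hw hb1 (by rw [hxa]; exact hwa.symm) hxb hwb
        hya hyb hab
    · exact no_triple hconv u f hf hx ha hb hx1 ha1 hb1 hxa hxb hab hya hyb hab
  have hc := key1 _ w hwc hwa hwb
  have hc1 : Tendsto (fun n => f n • (f n)⁻¹ • w) u (nhds w) := by simp
  have key2 : ∀ (y : ℕ → Y) (y0 : Y), Tendsto y u (nhds y0) → y0 ≠ a →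
      Tendsto (fun n => (f n)⁻¹ • y n) u (nhds b) := by
    intro y y0 hy hya
    by_cases hyb : y0 = b
    · obtain ⟨x, hx⟩ := ulim u (fun n => (f n)⁻¹ • y n)
      by_cases hxb : x = b
      · rwa [hxb] at hx
      exfalso
      have hx1 : Tendsto (fun n => f n • (f n)⁻¹ • y n) u (nhds y0) := by simpa using hy
      have hyw : y0 ≠ w := by rw [hyb]; exact hwb.symm
      by_cases hxa : x = a
      · exact no_triple hconv u f hf hx hwc hc hx1 hw hc1 (by rw [hxa]; exact hwa.symm) hxb hwb
          hya hyw hwa.symm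
      · exact no_triple hconv u f hf hx ha hc hx1 ha1 hc1 hxa hxb hab hya hyw hwa.symm
    · exact key1 y y0 hy hya hyb
  by_contra hcon
  rw [← Ultrafilter.eventually_not] at hcon
  have : ∀ n, ∃ y, y ∉ U ∧ ((¬ ∀ y, y ∉ U → (f n)⁻¹ • y ∈ V) → (f n)⁻¹ • y ∉ V) ∨
      ((∀ y, y ∉ U → (f n)⁻¹ • y ∈ V)) := by
    intro n
    by_cases h : ∀ y, y ∉ U → (f n)⁻¹ • y ∈ V
    · exact ⟨a, Or.inr h⟩
    · push Not at h
      obtain ⟨y, h1, h2⟩ := h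
      exact ⟨y, Or.inl ⟨h1, fun _ => h2⟩⟩
  choose y hy using this
  have hy1 : ∀ᶠ n in (u : Filter ℕ), y n ∈ Uᶜ ∧ (f n)⁻¹ • y n ∈ Vᶜ := by
    filter_upwards [hcon] with n hn
    rcases hy n with h | h
    · exact ⟨h.1, h.2 hn⟩
    · exact absurd h hn
  obtain ⟨y0, hy0⟩ := ulim u y
  have h1 : y0 ∈ Uᶜ := hU.isClosed_compl.mem_of_tendsto hy0 (hy1.mono fun n h => h.1)
  have h2 : b ∈ Vᶜ := hV.isClosed_compl.mem_of_tendsto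
    (key2 y y0 hy0 (fun h => h1 (h ▸ haU))) (hy1.mono fun n h => h.2)
  exact h2 hbV

lemma no_loxo {Γ Y : Type*} [Group Γ]
    [TopologicalSpace Y] [CompactSpace Y] [MulAction Γ Y]
    (hcont : ∀ γ : Γ, Continuous fun y : Y => γ • y) (p : Y)
    (hprop : ∀ K : Set Y, IsCompact K → K ⊆ {y : Y | y ≠ p} →
          Set.Finite {γ : Γ | γ • p = p ∧ ∃ y ∈ K, γ • y ∈ K})
    (g s : Γ) (hs : s • p = p) {U V : Set Y} (hU : IsOpen U) (hUV : Disjoint U V)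
    (hp : g • p ∈ U) {w : Y} (hwU : w ∉ U) (hwV : w ∉ V)
    (hφ : ∀ x, x ∉ U → (g * s * g⁻¹) • x ∈ V) : False := by
  have hVU : ∀ x ∈ V, x ∉ U := fun x hx hx' => Set.disjoint_left.1 hUV hx' hx
  have hpow : ∀ k : ℕ, (g * s * g⁻¹) ^ (k + 1) • w ∈ V := by
    intro k
    induction k with
    | zero => simpa using hφ w hwU
    | succ k ih =>
      rw [pow_succ', mul_smul]
      exact hφ _ (hVU _ ih)
  have hK : IsCompact ((fun y : Y => g • y) ⁻¹' Uᶜ) :=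
    (hU.isClosed_compl.preimage (hcont g)).isCompact
  have hfin := hprop _ hK (by
    intro y hy h
    subst h
    exact hy hp)
  have hsp : ∀ k : ℕ, s ^ k • p = p := by
    intro k
    induction k with
    | zero => simp
    | succ k ih => rw [pow_succ, mul_smul, hs, ih]
  have hmem : ∀ k : ℕ, s ^ (k + 1) ∈ {γ : Γ | γ • p = p ∧ ∃ y ∈ ((fun y : Y => g • y) ⁻¹' Uᶜ),
      γ • y ∈ ((fun y : Y => g • y) ⁻¹' Uᶜ)} := by
    intro k
    refine ⟨hsp _, g⁻¹ • w, by simpa using hwU, ?_⟩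
    have := hVU _ (hpow k)
    rw [conj_pow] at this
    simpa [mul_smul] using this
  have hninj : ¬ Function.Injective (fun k : ℕ => s ^ (k + 1)) := by
    intro hinj
    exact Set.infinite_of_injective_forall_mem hinj hmem hfin
  have hord : IsOfFinOrder s := by
    by_contra hno
    apply hninj
    intro i j hij
    have := injective_pow_iff_not_isOfFinOrder.2 hno hij
    omega
  obtain ⟨m, hm, hm1⟩ := isOfFinOrder_iff_pow_eq_one.1 hord
  obtain ⟨k, rfl⟩ : ∃ k, m = k + 1 := ⟨m - 1, by omega⟩
  have := hpow k
  rw [conj_pow, hm1] at this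
  exact hwV (by simpa using this)

/-- Let `Γ` be a (discrete) group acting by homeomorphisms on a compact
metrizable space `Y` with at least three points, such that the action on the space of
distinct triples is properly discontinuous (a convergence action).  If `p ∈ Y` is a conical
point — there are `γ_n ∈ Γ` and distinct `a, b ∈ Y` with `γ_n·p → a` and `γ_n·y → b` for
all `y ≠ p` — then `p` is not a bounded parabolic point, i.e. it is not the case that
`Stab_Γ(p)` is infinite and acts properly discontinuously and cocompactly on `Y \ {p}`. -/
theorem conical_not_bounded_parabolic {Γ Y : Type*} [Group Γ]
    [TopologicalSpace Y] [CompactSpace Y] [TopologicalSpace.MetrizableSpace Y]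
    [MulAction Γ Y] (hcont : ∀ γ : Γ, Continuous fun y : Y => γ • y)
    (h3 : ∃ a b c : Y, a ≠ b ∧ a ≠ c ∧ b ≠ c)
    (hconv : ∀ K : Set (Y × Y × Y), IsCompact K →
      (∀ t ∈ K, t.1 ≠ t.2.1 ∧ t.1 ≠ t.2.2 ∧ t.2.1 ≠ t.2.2) →
      Set.Finite {γ : Γ | ∃ t ∈ K, ((γ • t.1, γ • t.2.1, γ • t.2.2) : Y × Y × Y) ∈ K})
    (p : Y)
    (hconical : ∃ (γ : ℕ → Γ) (a b : Y), a ≠ b ∧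
      Tendsto (fun n => γ n • p) atTop (nhds a) ∧
      ∀ y : Y, y ≠ p → Tendsto (fun n => γ n • y) atTop (nhds b)) :
    ¬ (Set.Infinite {γ : Γ | γ • p = p} ∧
        (∀ K : Set Y, IsCompact K → K ⊆ {y : Y | y ≠ p} →
          Set.Finite {γ : Γ | γ • p = p ∧ ∃ y ∈ K, γ • y ∈ K}) ∧
        (∃ K : Set Y, IsCompact K ∧ K ⊆ {y : Y | y ≠ p} ∧
          ∀ y : Y, y ≠ p → ∃ γ : Γ, γ • p = p ∧ γ • y ∈ K)) := by
  rintro ⟨hinf, hprop, K, hK, hKp, hcoc⟩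
  obtain ⟨γ, a, b, hab, hpa, hyb⟩ := hconical
  obtain ⟨w, hwa, hwb⟩ : ∃ w : Y, w ≠ a ∧ w ≠ b := by
    obtain ⟨x, y, z, h1, h2, h3⟩ := h3
    by_contra! hc
    have hx := hc x
    have hy := hc y
    have hz := hc z
    by_cases ex : x = a
    · have ey := hy (fun h => h1 (ex.trans h.symm))
      have ez := hz (fun h => h2 (ex.trans h.symm))
      exact h3 (ey.trans ez.symm)
    · by_cases ey : y = a
      · have ez := hz (fun h => h3 (ey.trans h.symm))
        exact h2 ((hx ex).trans ez.symm)
      · exact h1 ((hx ex).trans (hy ey).symm)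
  obtain ⟨z, hz⟩ : ∃ z : Y, z ≠ p := by
    by_contra! hc
    exact hwa ((hc w).trans (hc a).symm)
  -- disjoint neighbourhoods
  obtain ⟨U, V, hU, hV, haU, hbV, hUV, hwU, hwV⟩ : ∃ U V : Set Y, IsOpen U ∧ IsOpen V ∧ a ∈ U ∧
      b ∈ V ∧ Disjoint U V ∧ w ∉ U ∧ w ∉ V := by
    obtain ⟨U, V, hU, hV, haU, hbV, hUV⟩ := t2_separation hab
    refine ⟨U \ {w}, V \ {w}, hU.sdiff isClosed_singleton, hV.sdiff isClosed_singleton,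
      ⟨haU, hwa.symm⟩, ⟨hbV, hwb.symm⟩, hUV.mono Set.sdiff_subset Set.sdiff_subset, ?_, ?_⟩ <;> simp
  have claim : ∀ h : Γ, h • p = p → ∀ᶠ n in atTop, (γ n * h * (γ n)⁻¹) • b = b := by
    intro h hh
    by_contra hcon
    have hcon' : ∃ᶠ n in atTop, (γ n * h * (γ n)⁻¹) • b ≠ b :=
      Filter.not_eventually.1 hcon
    have hne := Filter.frequently_iff_neBot.1 hcon'
    set u := @Ultrafilter.of ℕ _ hne with hu
    have hule := @Ultrafilter.of_le ℕ _ hne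
    have hu1 : (u : Filter ℕ) ≤ atTop := hule.trans inf_le_left
    have hu2 : ∀ᶠ n in (u : Filter ℕ), (γ n * h * (γ n)⁻¹) • b ≠ b :=
      Filter.le_principal_iff.1 (hule.trans inf_le_right)
    have hhz : h • z ≠ p := by
      intro hc
      rw [← hh] at hc
      exact hz (smul_left_cancel h (hc.trans (by rw [hh])))
    have A : Tendsto (fun n => γ n • p) u (nhds a) := hpa.mono_left hu1
    have A1 : Tendsto (fun n => (γ n * h * (γ n)⁻¹) • γ n • p) u (nhds a) := by
      simpa [mul_smul, hh] using A
    have B : Tendsto (fun n => γ n • z) u (nhds b) := (hyb z hz).mono_left hu1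
    have B1 : Tendsto (fun n => (γ n * h * (γ n)⁻¹) • γ n • z) u (nhds b) := by
      simpa [mul_smul] using (hyb _ hhz).mono_left hu1
    by_cases hf : ∀ g, ∀ᶠ n in (u : Filter ℕ), γ n * h * (γ n)⁻¹ ≠ g
    · obtain ⟨c, hc⟩ := ulim u (fun n => (γ n * h * (γ n)⁻¹) • w)
      have hpU : ∀ᶠ n in (u : Filter ℕ), γ n • p ∈ U := A (hU.mem_nhds haU)
      by_cases hca : c = a
      · rw [hca] at hc
        have hl := loxo hconv u _ hf hab hwa hwb A B A1 B1 hc hU hV haU hbV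
        obtain ⟨n, hn1, hn2⟩ := (hl.and hpU).exists
        refine no_loxo hcont p hprop (γ n) h⁻¹ (by rw [inv_smul_eq_iff, hh]) hU hUV hn2 hwU hwV ?_
        intro x hx
        have := hn1 x hx
        simpa [mul_assoc] using this
      by_cases hcb : c = b
      · rw [hcb] at hc
        have hl := loxo hconv u _ hf hab.symm hwb hwa B A B1 A1 hc hV hU hbV haU
        obtain ⟨n, hn1, hn2⟩ := (hl.and hpU).exists
        refine no_loxo hcont p hprop (γ n) h hh hU hUV hn2 hwU hwV ?_
        intro x hx
        by_contra hx'
        have := hn1 _ hx'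
        rw [inv_smul_smul] at this
        exact hx this
      · exact no_triple hconv u _ hf A B tendsto_const_nhds A1 B1 hc hab hwa.symm hwb.symm
          hab (Ne.symm hca) (Ne.symm hcb)
    · push Not at hf
      obtain ⟨g, hg⟩ := hf
      have hg' : ∀ᶠ n in (u : Filter ℕ), γ n * h * (γ n)⁻¹ = g := by
        rw [← Ultrafilter.frequently_iff_eventually]
        simpa using hg
      have l1 : Tendsto (fun n => g • γ n • z) u (nhds (g • b)) := ((hcont g).tendsto b).comp B
      have l2 : Tendsto (fun n => g • γ n • z) u (nhds b) := by
        refine B1.congr' ?_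
        filter_upwards [hg'] with n hn
        rw [hn]
      have hgb := tendsto_nhds_unique l1 l2
      obtain ⟨n, h1, h2⟩ := (hg'.and hu2).exists
      rw [h1] at h2
      exact h2 hgb
  have hE := hprop K hK hKp
  obtain ⟨S, hS, hcard⟩ := hinf.exists_subset_card_eq (hE.toFinset.card + 1)
  have hall : ∀ᶠ n in atTop, ∀ s ∈ S, (γ n * s * (γ n)⁻¹) • b = b :=
    (Filter.eventually_all_finset S).2 (fun s hs => claim s (hS hs))
  have hne : ∀ᶠ n in atTop, γ n • p ≠ b := hpa.eventually_ne hab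
  obtain ⟨n, hn1, hn2⟩ := (hall.and hne).exists
  obtain ⟨t, ht, htK⟩ := hcoc ((γ n)⁻¹ • b) (by
    intro hc
    exact hn2 (by rw [← hc, smul_inv_smul]))
  have hle : S.card ≤ hE.toFinset.card := by
    refine Finset.card_le_card_of_injOn (fun s => t * s * t⁻¹) ?_ ?_
    · intro s hs
      have hsp : s • p = p := hS hs
      have htp : t⁻¹ • p = p := by rw [inv_smul_eq_iff, ht]
      have hfix : s • (γ n)⁻¹ • b = (γ n)⁻¹ • b := by
        have := hn1 s hs
        rw [mul_smul, mul_smul] at this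
        exact eq_inv_smul_iff.2 this
      simp only [Set.Finite.coe_toFinset, Set.mem_ofPred_eq]
      refine ⟨by rw [mul_smul, mul_smul, htp, hsp, ht], _, htK, ?_⟩
      rw [mul_smul, mul_smul, inv_smul_smul, hfix]
      exact htK
    · intro s _ s' _ hss
      simpa using hss
  omega
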